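/- Let T_0 ∈ (0, π) with 2π/T_0 ∉ ℕ, set N := ⌊2π/T_0⌋ and j := ⌊π/T_0⌋, and suppose N is even and j is odd. Define h* := ⌈ (π − j·T_0 + T_0) / (2π − N·T_0) ⌉ and k* := ⌈ T_0 / (2π − N·T_0) ⌉. Then the set { t > 0 : μ((D(T_0,t))ᶜ) = 0 } is nonempty and: if h* = k* + 1 then T_opt(T_0) = π + T_0·(N·k* + 1), while if h* = k* then T_opt(T_0) = π + T_0·(N·k* − j + 1). -/

import Mathlib

open MeasureTheory Set Real Filter Topology

noncomputable section

instance : Fact (0 < 2 * Real.pi) := ⟨by positivity⟩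

/-- λ_k: 0 for even k, π for odd k. -/
def lam (k : ℕ) : ℝ := if Even k then 0 else Real.pi

/-- Covered set D(T₀, t) ⊆ ℝ/(2πℤ): the union over k of the projections of the
observation intervals (k·T₀, min((k+1)·T₀, t)) translated by −λ_k. -/
def coveredSet (T0 t : ℝ) : Set (AddCircle (2 * Real.pi)) :=
  ⋃ k : ℕ, (fun a : ℝ => ((a - lam k : ℝ) : AddCircle (2 * Real.pi))) ''
    Set.Ioo ((k : ℝ) * T0) (min (((k : ℝ) + 1) * T0) t)

/-- Optimal control time T_opt(T₀). -/
def Topt (T0 : ℝ) : ℝ :=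
  sInf { t : ℝ | 0 < t ∧ volume (coveredSet T0 t)ᶜ = 0 }

/-- Parametrisation: every lift of an observation point. -/
lemma lam_lift (k : ℕ) (m : ℤ) : ∃ p : ℤ, Even ((k : ℤ) - p) ∧ lam k + m * (2 * Real.pi) = p * Real.pi := by
  unfold lam
  split_ifs with h
  · refine ⟨2 * m, ?_, by push_cast; ring⟩
    have : Even (k : ℤ) := by exact_mod_cast h
    exact this.sub (even_two_mul m)
  · refine ⟨2 * m + 1, ?_, by push_cast; ring⟩
    have : Odd (k : ℤ) := by exact_mod_cast (Nat.not_even_iff_odd.mp h)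
    exact this.sub_odd (odd_two_mul_add_one m)

lemma lam_lift' (k : ℕ) (p : ℤ) (h : Even ((k : ℤ) - p)) :
    ∃ m : ℤ, lam k = p * Real.pi + m * (2 * Real.pi) := by
  unfold lam
  split_ifs with hk
  · have hk' : Even (k : ℤ) := by exact_mod_cast hk
    have : Even p := by simpa using hk'.sub h
    obtain ⟨q, rfl⟩ := this
    exact ⟨-q, by push_cast; ring⟩
  · have hk' : Odd (k : ℤ) := by exact_mod_cast (Nat.not_even_iff_odd.mp hk)
    have : Odd p := by simpa using hk'.sub_even h
    obtain ⟨q, rfl⟩ := this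
    exact ⟨-q, by push_cast; ring⟩

lemma mem_cov (T0 e t x : ℝ) (j k : ℕ) (p : ℤ) (hj : Odd j) (hpi : Real.pi = j * T0 + e)
    (i : ℤ) (hi : Even i) (hk : (k : ℤ) = i + p * j)
    (h0 : 0 < x - (i * T0 - p * e)) (h1 : x - (i * T0 - p * e) < T0)
    (h2 : k * T0 + (x - (i * T0 - p * e)) < t) :
    (x : AddCircle (2 * Real.pi)) ∈ coveredSet T0 t := by
  have hj' : Odd (j : ℤ) := by exact_mod_cast hj
  have he : Even ((k : ℤ) - p) := by
    have : (k : ℤ) - p = i + p * (j - 1) := by rw [hk]; ring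
    rw [this]
    exact hi.add ((hj'.sub_odd odd_one).mul_left p)
  obtain ⟨m, hm⟩ := lam_lift' k p he
  refine mem_iUnion.2 ⟨k, k * T0 + (x - (i * T0 - p * e)), ⟨by linarith, lt_min (by linarith) h2⟩, ?_⟩
  have hkr : (k : ℝ) = i + p * j := by exact_mod_cast hk
  have : k * T0 + (x - (i * T0 - p * e)) - lam k = x + (-m : ℤ) • (2 * Real.pi) := by
    rw [hm, hkr]; simp only [zsmul_eq_mul]; push_cast
    nth_rw 1 [hpi]; ring
  simp only [this]
  rw [AddCircle.coe_add, AddCircle.coe_zsmul, AddCircle.coe_period]; simp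

lemma of_mem_cov (T0 e t x : ℝ) (j : ℕ) (hj : Odd j) (hpi : Real.pi = j * T0 + e)
    (hx : (x : AddCircle (2 * Real.pi)) ∈ coveredSet T0 t) :
    ∃ (k : ℕ) (p i : ℤ) (u : ℝ), Even i ∧ (k : ℤ) = i + p * j ∧ x = i * T0 - p * e + u ∧
      0 < u ∧ u < T0 ∧ k * T0 + u < t := by
  have hj' : Odd (j : ℤ) := by exact_mod_cast hj
  obtain ⟨k, a, ⟨h1, h2⟩, h3⟩ := mem_iUnion.1 hx
  have h4 : a - lam k - x = a - lam k - x := rfl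
  rw [← sub_eq_zero, ← AddCircle.coe_sub, AddCircle.coe_eq_zero_iff] at h3
  obtain ⟨m, hm⟩ := h3
  rw [zsmul_eq_mul] at hm
  obtain ⟨p, hp, hp'⟩ := lam_lift k m
  have h5 := lt_min_iff.1 h2
  refine ⟨k, p, k - p * j, a - k * T0, ?_, by ring, ?_, by linarith, by linarith, by linarith⟩
  · have : (k : ℤ) - p * j = (k - p) - p * (j - 1) := by ring
    rw [this]
    exact hp.sub ((hj'.sub_odd odd_one).mul_left p)
  · push_cast
    have : x = a - p * Real.pi := by linarith
    rw [this, hpi]; ring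

lemma upper (T0 e : ℝ) (j P : ℕ) (hj : Odd j) (he : 0 < e) (heT : 2 * e < T0)
    (hpi : Real.pi = j * T0 + e) (hP : ((P : ℝ) - 1) * e < T0) (hP' : T0 ≤ P * e) :
    volume (coveredSet T0 (((P * j + j + 1 : ℕ) : ℝ) * T0 + e))ᶜ = 0 := by
  have hT : 0 < T0 := by linarith
  have hj1 : 1 ≤ j := hj.pos
  have hP3 : 1 ≤ P := by
    rcases Nat.eq_zero_or_pos P with h | h
    · subst h; simp at hP'; linarith
    · exact h
  have hc : (range (fun q : ℤ × ℤ => ((q.1 * T0 - q.2 * e : ℝ) : AddCircle (2 * Real.pi)))).Countable :=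
    countable_range _
  haveI : NullSingletonClass (volume : Measure (AddCircle (2 * Real.pi))) := ⟨fun x => by
    rw [← Metric.closedBall_zero, AddCircle.volume_closedBall]
    simp [Real.pi_pos.le]⟩
  refine measure_mono_null ?_ (hc.measure_zero volume)
  intro z hz
  by_contra hbad
  apply hz
  obtain ⟨x, hx, rfl⟩ : ∃ x ∈ Ico (0 : ℝ) (0 + 2 * Real.pi), (x : AddCircle (2 * Real.pi)) = z := by
    have := (AddCircle.coe_image_Ico_eq (2 * Real.pi) 0)
    have h := this ▸ mem_univ z
    simpa using h
  have hgen : ∀ a b : ℤ, x ≠ a * T0 - b * e := by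
    intro a b hab
    exact hbad ⟨(a, b), by simp [hab]⟩
  obtain ⟨hx0, hx1⟩ := hx
  rw [zero_add] at hx1
  -- slot
  set n : ℕ := ⌊x / (2 * T0)⌋₊ with hn
  have hn1 : (n : ℝ) * (2 * T0) ≤ x := by
    have := Nat.floor_le (show 0 ≤ x / (2 * T0) by positivity)
    rwa [le_div_iff₀ (by positivity)] at this
  have hn2 : x < ((n : ℝ) + 1) * (2 * T0) := by
    have := Nat.lt_floor_add_one (x / (2 * T0))
    rwa [div_lt_iff₀ (by positivity)] at this
  have hnj : n ≤ j := by
    by_contra h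
    have : (j : ℝ) + 1 ≤ n := by exact_mod_cast (not_le.1 h)
    nlinarith
  have hPj : j ≤ P * j := Nat.le_mul_of_pos_left j hP3
  have hcast : ∀ k : ℕ, k + 1 ≤ P * j + j + 1 → (k : ℝ) * T0 + T0 ≤ ((P * j + j + 1 : ℕ) : ℝ) * T0 := by
    intro k hk
    have : ((k : ℝ) + 1) ≤ ((P * j + j + 1 : ℕ) : ℝ) := by exact_mod_cast hk
    nlinarith
  have hg1 := hgen (2 * n) 0
  have hg2 := hgen (2 * n + 1) 0
  push_cast at hg1 hg2
  rcases lt_or_ge x ((2 * n + 1) * T0) with hlt | hge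
  · have hlow : (n : ℝ) * (2 * T0) < x := lt_of_le_of_ne hn1 (fun h => hg1 (by linarith))
    have := hcast (2 * n) (by omega)
    push_cast at this
    refine mem_cov T0 e _ x j (2 * n) 0 hj hpi (2 * n) (even_two_mul _) (by push_cast; ring) ?_ ?_ ?_ <;>
    · push_cast; linarith
  have hnj' : n + 1 ≤ j := by
    by_contra h
    have h2 : n = j := by omega
    rw [h2] at hge
    linarith
  set y : ℝ := (2 * n + 2) * T0 - x with hy
  have hy0 : 0 < y := by linarith
  have hy1 : y ≤ T0 := by linarith
  set p : ℕ := ⌈y / e⌉₊ with hp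
  have hp1 : y ≤ p * e := by
    have := Nat.le_ceil (y / e)
    rwa [div_le_iff₀ he] at this
  have hp2 : p * e < y + e := by
    have := Nat.ceil_lt_add_one (show 0 ≤ y / e by positivity)
    have h2 := mul_lt_mul_of_pos_right this he
    rw [add_mul, div_mul_cancel₀ _ he.ne'] at h2
    linarith
  have hp3 : y < p * e := by
    refine lt_of_le_of_ne hp1 fun h => hgen (2 * n + 2) p ?_
    push_cast; linarith
  have hpP : p ≤ P := by
    by_contra h
    have : (P : ℝ) + 1 ≤ p := by exact_mod_cast (not_le.1 h)
    nlinarith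
  by_cases hgood : 2 * n + 2 + p * j ≤ P * j + j + 1
  · have : (((2 * n + 2 + p * j : ℕ) : ℝ)) ≤ ((P * j + j + 1 : ℕ) : ℝ) := by exact_mod_cast hgood
    have h3 := mul_le_mul_of_nonneg_right this hT.le
    refine mem_cov T0 e _ x j (2 * n + 2 + p * j) p hj hpi (2 * n + 2) ⟨n + 1, by ring⟩
      (by push_cast; ring) ?_ ?_ ?_
    · push_cast; linarith
    · push_cast; linarith
    · have : x - (((2 * n + 2 : ℤ) : ℝ) * T0 - ((p : ℤ) : ℝ) * e) < e := by push_cast; linarith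
      linarith
  · have hpe : p = P := by
      by_contra h
      have h1 : p + 1 ≤ P := by omega
      have := Nat.mul_le_mul_right j h1
      apply hgood
      nlinarith
    rw [hpe] at hgood hp2
    have hnn : j ≤ 2 * n := by omega
    have h3 := hcast (2 * n - j) (by omega)
    refine mem_cov T0 e _ x j (2 * n - j) (-1) hj hpi (2 * n) (even_two_mul _)
      (by push_cast [hnn]; ring) ?_ ?_ ?_
    · push_cast; linarith
    · push_cast; linarith
    · have : x - (((2 * n : ℤ) : ℝ) * T0 - ((-1 : ℤ) : ℝ) * e) < T0 := by push_cast; linarith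
      linarith

lemma lower (T0 e t : ℝ) (j P : ℕ) (hj : Odd j) (he : 0 < e) (heT : 2 * e < T0)
    (hpi : Real.pi = j * T0 + e) (hP : ((P : ℝ) - 1) * e < T0) (hP' : T0 ≤ P * e)
    (ht : t < ((P * j + j + 1 : ℕ) : ℝ) * T0 + e) :
    volume (coveredSet T0 t)ᶜ ≠ 0 := by
  have hT : 0 < T0 := by linarith
  have hj1 : 1 ≤ j := hj.pos
  have hP1 : (1 : ℝ) ≤ P := by
    rcases Nat.eq_zero_or_pos P with h | h
    · subst h; simp at hP'; linarith
    · exact_mod_cast h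
  set σ : ℝ := ((P : ℝ) - 1) * e with hσ
  have hσ0 : 0 ≤ σ := mul_nonneg (by linarith) he.le
  obtain ⟨ε, hε, hε1, hε2⟩ : ∃ ε : ℝ, 0 < ε ∧ ε ≤ T0 - σ ∧
      ε ≤ ((P * j + j + 1 : ℕ) : ℝ) * T0 + e - t :=
    ⟨min (T0 - σ) (((P * j + j + 1 : ℕ) : ℝ) * T0 + e - t), lt_min (by linarith) (by linarith),
      min_le_left _ _, min_le_right _ _⟩
  set U : Set (AddCircle (2 * Real.pi)) :=
    (fun x : ℝ => (x : AddCircle (2 * Real.pi))) '' Ioo ((j + 1) * T0 - σ - ε) ((j + 1) * T0 - σ) with hU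
  have hUo : IsOpen U := QuotientAddGroup.isOpenMap_coe _ isOpen_Ioo
  have hUn : U.Nonempty := (nonempty_Ioo.2 (by linarith)).image _
  have hsub : U ⊆ (coveredSet T0 t)ᶜ := by
    rintro _ ⟨x, ⟨hx1, hx2⟩, rfl⟩ hmem
    obtain ⟨k, p, i, u, hi, hk, hxe, hu0, hu1, hut⟩ := of_mem_cov T0 e t x j hj hpi hmem
    have hkM : k < P * j + j + 1 + 1 := by
      have : (k : ℝ) * T0 < ((P * j + j + 1 + 1 : ℕ) : ℝ) * T0 := by
        push_cast at ht ⊢; linarith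
      exact_mod_cast lt_of_mul_lt_mul_right this hT.le
    have hkr : (k : ℝ) = i + p * j := by exact_mod_cast hk
    have hje : Even ((j : ℤ) + 1) := by
      have : Odd (j : ℤ) := by exact_mod_cast hj
      exact this.add_one
    obtain ⟨l, hl⟩ := hi.sub hje
    have hil : i = j + 1 + 2 * l := by linarith
    have hilr : (i : ℝ) = j + 1 + 2 * l := by exact_mod_cast hil
    have hmain : 2 * l * T0 + u + ((j + 1) * T0 - x) = p * e := by
      rw [hxe, hilr]; ring
    have hj1z : (1 : ℤ) ≤ j := by exact_mod_cast hj1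
    have hkz : (k : ℤ) ≤ P * j + j + 1 := by exact_mod_cast Nat.lt_succ_iff.1 hkM
    have hk0 : (0 : ℤ) ≤ k := Int.natCast_nonneg k
    rcases lt_or_ge l 0 with hl0 | hl0
    · have hlr : (l : ℝ) ≤ -1 := by exact_mod_cast (show l ≤ -1 by omega)
      have hpe : (p : ℝ) * e < 0 := by nlinarith
      have hp : (p : ℝ) < 0 := by
        by_contra h
        nlinarith [mul_nonneg (not_lt.1 h) he.le]
      have hp' : p ≤ -1 := by
        have : p < 0 := by exact_mod_cast hp
        omega
      nlinarith
    · have hlr : (0 : ℝ) ≤ l := by exact_mod_cast hl0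
      have hpe : ((P : ℝ) - 1) * e < p * e := by nlinarith [mul_nonneg hlr hT.le]
      have hp := lt_of_mul_lt_mul_right hpe he.le
      have hp' : (P : ℤ) ≤ p := by
        have : (P : ℤ) - 1 < p := by exact_mod_cast hp
        omega
      have h6 : (P : ℤ) * j ≤ p * j := mul_le_mul_of_nonneg_right hp' (by omega)
      have hl1 : l = 0 := by linarith
      have hpP : p = P := by
        by_contra h
        have : (P : ℤ) + 1 ≤ p := by omega
        nlinarith
      have hkM' : (k : ℝ) = ((P * j + j + 1 : ℕ) : ℝ) := by
        rw [hkr, hilr, hpP, hl1]; push_cast; ring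
      rw [hkM'] at hut
      rw [hl1, hpP] at hmain
      push_cast at hmain
      have : σ = P * e - e := by rw [hσ]; ring
      linarith
  intro h0
  exact (hUo.measure_pos volume hUn).ne' (measure_mono_null hsub h0)

lemma Topt_eq (T0 e : ℝ) (j P : ℕ) (hj : Odd j) (he : 0 < e) (heT : 2 * e < T0)
    (hpi : Real.pi = j * T0 + e) (hP : ((P : ℝ) - 1) * e < T0) (hP' : T0 ≤ P * e) :
    { t : ℝ | 0 < t ∧ volume (coveredSet T0 t)ᶜ = 0 }.Nonempty ∧
    Topt T0 = ((P * j + j + 1 : ℕ) : ℝ) * T0 + e := by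
  have hm : ((P * j + j + 1 : ℕ) : ℝ) * T0 + e ∈ { t : ℝ | 0 < t ∧ volume (coveredSet T0 t)ᶜ = 0 } := by
    have : 0 < T0 := by linarith
    exact ⟨by positivity, upper T0 e j P hj he heT hpi hP hP'⟩
  refine ⟨⟨_, hm⟩, le_antisymm (csInf_le ⟨0, fun t ht => ht.1.le⟩ hm) (le_csInf ⟨_, hm⟩ ?_)⟩
  intro t ht
  by_contra h
  exact lower T0 e t j P hj he heT hpi hP hP' (not_le.1 h) ht.2

/-- Lemma 1.8 ii): T₀ ∈ (0,π), 2π/T₀ ∉ ℕ, N = ⌊2π/T₀⌋ even and j = ⌊π/T₀⌋ odd. With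
h* = ⌈(π − jT₀ + T₀)/(2π − NT₀)⌉ and k* = ⌈T₀/(2π − NT₀)⌉, the system is observable
and T_opt = π + T₀(Nk* + 1) if h* = k* + 1, while T_opt = π + T₀(Nk* − j + 1) if h* = k*. -/
theorem stmt_13 (T0 : ℝ) (hT0 : T0 ∈ Set.Ioo 0 Real.pi)
    (hnotnat : ¬ ∃ m : ℕ, 2 * Real.pi / T0 = (m : ℝ))
    (N j : ℕ) (hN : N = ⌊2 * Real.pi / T0⌋₊) (hj : j = ⌊Real.pi / T0⌋₊)
    (hNe : Even N) (hjo : Odd j)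
    (hstar kstar : ℕ)
    (hh : hstar = ⌈(Real.pi - (j : ℝ) * T0 + T0) / (2 * Real.pi - (N : ℝ) * T0)⌉₊)
    (hk : kstar = ⌈T0 / (2 * Real.pi - (N : ℝ) * T0)⌉₊) :
    { t : ℝ | 0 < t ∧ volume (coveredSet T0 t)ᶜ = 0 }.Nonempty ∧
      (hstar = kstar + 1 → Topt T0 = Real.pi + T0 * ((N : ℝ) * kstar + 1)) ∧
      (hstar = kstar → Topt T0 = Real.pi + T0 * ((N : ℝ) * kstar - (j : ℝ) + 1)) := by
  obtain ⟨hT, hTpi⟩ := hT0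
  have hpi0 := Real.pi_pos
  have hN1 : (N : ℝ) * T0 ≤ 2 * Real.pi := by
    have := Nat.floor_le (show 0 ≤ 2 * Real.pi / T0 by positivity)
    rwa [← hN, le_div_iff₀ hT] at this
  have hN2 : 2 * Real.pi < (N + 1) * T0 := by
    have := Nat.lt_floor_add_one (2 * Real.pi / T0)
    rwa [← hN, div_lt_iff₀ hT] at this
  have hN3 : (N : ℝ) * T0 ≠ 2 * Real.pi := fun h => hnotnat ⟨N, by rw [← h]; field_simp⟩
  have hN4 : (N : ℝ) * T0 < 2 * Real.pi := lt_of_le_of_ne hN1 hN3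
  have hNj : N = 2 * j := by
    obtain ⟨n, hn⟩ := hNe
    have : j = n := by
      rw [hj]
      have hnr : (N : ℝ) = n + n := by exact_mod_cast hn
      rw [Nat.floor_eq_iff (by positivity), le_div_iff₀ hT, div_lt_iff₀ hT]
      rw [hnr] at hN1 hN2
      constructor <;> linarith
    omega
  have hNr : (N : ℝ) = 2 * j := by exact_mod_cast hNj
  obtain ⟨e, hpi⟩ : ∃ e : ℝ, Real.pi = j * T0 + e := ⟨Real.pi - j * T0, by ring⟩
  have hd : 2 * Real.pi - (N : ℝ) * T0 = 2 * e := by rw [hNr, hpi]; ring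
  have he : 0 < e := by linarith
  have heT : 2 * e < T0 := by linarith
  have hn : Real.pi - (j : ℝ) * T0 + T0 = e + T0 := by rw [hpi]; ring
  rw [hd] at hh hk
  rw [hn] at hh
  have hk1 : T0 ≤ kstar * (2 * e) := by
    have := Nat.le_ceil (T0 / (2 * e))
    rwa [← hk, div_le_iff₀ (by positivity)] at this
  have hk2 : (kstar : ℝ) * (2 * e) < T0 + 2 * e := by
    have := Nat.ceil_lt_add_one (show 0 ≤ T0 / (2 * e) by positivity)
    rw [← hk] at this
    have h2 := mul_lt_mul_of_pos_right this (show 0 < 2 * e by positivity)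
    rw [add_mul, div_mul_cancel₀ _ (by positivity)] at h2
    linarith
  have hh1 : e + T0 ≤ hstar * (2 * e) := by
    have := Nat.le_ceil ((e + T0) / (2 * e))
    rwa [← hh, div_le_iff₀ (by positivity)] at this
  have hh2 : (hstar : ℝ) * (2 * e) < e + T0 + 2 * e := by
    have := Nat.ceil_lt_add_one (show 0 ≤ (e + T0) / (2 * e) by positivity)
    rw [← hh] at this
    have h2 := mul_lt_mul_of_pos_right this (show 0 < 2 * e by positivity)
    rw [add_mul, div_mul_cancel₀ _ (by positivity)] at h2
    linarith
  have hkpos : 1 ≤ kstar := by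
    rcases Nat.eq_zero_or_pos kstar with h | h
    · rw [h] at hk1; simp at hk1; linarith
    · exact h
  refine ⟨?_, ?_, ?_⟩
  · refine (Topt_eq T0 e j ⌈T0 / e⌉₊ hjo he heT hpi ?_ ?_).1
    · have := Nat.ceil_lt_add_one (show 0 ≤ T0 / e by positivity)
      rwa [← sub_lt_iff_lt_add, lt_div_iff₀ he] at this
    · have := Nat.le_ceil (T0 / e)
      rwa [div_le_iff₀ he] at this
  · intro h
    rw [h] at hh1 hh2
    push_cast at hh1 hh2
    rw [(Topt_eq T0 e j (2 * kstar) hjo he heT hpi (by push_cast; linarith)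
      (by push_cast; linarith)).2, hNr]
    push_cast
    linear_combination -hpi
  · intro h
    rw [h] at hh1 hh2
    have hc : ((2 * kstar - 1 : ℕ) : ℝ) = 2 * kstar - 1 := by
      rw [Nat.cast_sub (by omega)]; push_cast; ring
    rw [(Topt_eq T0 e j (2 * kstar - 1) hjo he heT hpi (by rw [hc]; linarith)
      (by rw [hc]; linarith)).2, hNr]
    rw [Nat.cast_add, Nat.cast_add, Nat.cast_mul, hc]
    push_cast
    linear_combination -hpi
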